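/- For every R > 0 there exists a constant C > 0 (depending only on R) such that for all integers k ≥ 1, ℓ ≥ 2(2k−1), and 1 ≤ i ≤ 2k−1, the vector β_i := V^{−1} e_i satisfies |(β_i)_a| ≤ 2^{C · ℓ · log ℓ} for every a ∈ {0, …, ℓ−1}. -/

import Mathlib

open MeasureTheory Real Finset Matrix

/-- Probabilists' Hermite polynomial evaluated at a real number. -/
noncomputable def hermiteR (j : ℕ) (x : ℝ) : ℝ := Polynomial.aeval x (Polynomial.hermite j)

/-- `J_{f,j} = ∫_S f(x) · (1/(√(2π)·j!)) · e^{-x²/2} · h_j(x) dx`, where `S = [-R, R]`. -/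
noncomputable def Jint (R : ℝ) (f : ℝ → ℝ) (j : ℕ) : ℝ :=
  ∫ x in Set.Icc (-R) R,
    f x * (1 / (Real.sqrt (2 * π) * (Nat.factorial j))) * Real.exp (-x ^ 2 / 2) * hermiteR j x

/-- The `ℓ×ℓ` matrix `V` with entries `V_{r,c} = J_{h_c, r}`. -/
noncomputable def Vmat (R : ℝ) (ℓ : ℕ) : Matrix (Fin ℓ) (Fin ℓ) ℝ :=
  Matrix.of fun r c : Fin ℓ => Jint R (hermiteR c) r


section helpers

open Polynomial

/-- Real Hermite polynomial. -/
noncomputable def HR (j : ℕ) : ℝ[X] := (Polynomial.hermite j).map (Int.castRingHom ℝ)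

lemma HR_eval (j : ℕ) (x : ℝ) : (HR j).eval x = hermiteR j x := by
  simp [HR, hermiteR, Polynomial.aeval_def, Polynomial.eval_map]

lemma HR_zero : HR 0 = 1 := by simp [HR]

lemma HR_succ (n : ℕ) : HR (n + 1) = X * HR n - derivative (HR n) := by
  simp [HR, Polynomial.hermite_succ, Polynomial.derivative_map]

lemma HR_deriv (n : ℕ) : derivative (HR (n + 1)) = ((n : ℝ[X]) + 1) * HR n := by
  induction n with
  | zero => simp [HR_succ, HR_zero]
  | succ m ih =>
    rw [HR_succ (m + 1), derivative_sub, derivative_mul, derivative_X, ih]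
    have h : derivative (((m : ℝ[X]) + 1) * HR m) = ((m : ℝ[X]) + 1) * derivative (HR m) := by
      rw [derivative_mul]; simp
    rw [h]
    have := HR_succ m
    push_cast
    linear_combination (-(m : ℝ[X]) - 1) * this

lemma X_mul_HR (n : ℕ) : X * HR n = HR (n + 1) + C (n : ℝ) * HR (n - 1) := by
  cases n with
  | zero => simp [HR_succ, HR_zero]
  | succ m =>
    have h1 := HR_succ (m + 1)
    rw [HR_deriv] at h1
    simp only [Nat.add_sub_cancel]
    rw [h1]; push_cast; simp

lemma HR_degree (n : ℕ) : (HR n).degree = n := by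
  rw [HR, (Polynomial.hermite_monic n).degree_map, Polynomial.degree_hermite]

lemma HR_monic (n : ℕ) : (HR n).Monic := (Polynomial.hermite_monic n).map _

/-- Hermite sequence. -/
noncomputable def HS : Polynomial.Sequence ℝ := ⟨HR, HR_degree⟩

lemma HS_unit (i : ℕ) : IsUnit (HS i).leadingCoeff := by
  have : (HS i).leadingCoeff = 1 := HR_monic i
  rw [this]; exact isUnit_one

/-- Hermite basis. -/
noncomputable def HB : Module.Basis ℕ ℝ ℝ[X] := HS.basis HS_unit

lemma HB_apply (i : ℕ) : HB i = HR i := HS.basis_eq_self HS_unit i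

inductive HermRep (n : ℕ) : ℝ → ℝ[X] → Prop
  | zero : HermRep n 0 0
  | add (c : ℝ) (j : ℕ) (hj : j ≤ n) (B : ℝ) (q : ℝ[X]) (h : HermRep n B q) :
      HermRep n (B + |c|) (q + C c * HR j)
  | mono (B B' : ℝ) (q : ℝ[X]) (hB : B ≤ B') (h : HermRep n B q) : HermRep n B' q

lemma HermRep.bound {n : ℕ} {B : ℝ} {q : ℝ[X]} (h : HermRep n B q) (a : ℕ) : |HB.repr q a| ≤ B := by
  induction h with
  | zero => simp
  | add c j hj B q h ih =>
    have h1 : HB.repr (q + C c * HR j) a = HB.repr q a + c * (Finsupp.single j (1 : ℝ)) a := by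
      rw [← Polynomial.smul_eq_C_mul, ← HB_apply]; simp [Finsupp.single_apply]
    rw [h1]
    refine (abs_add_le _ _).trans (add_le_add ih ?_)
    rw [abs_mul]
    apply mul_le_of_le_one_right (abs_nonneg _)
    rw [Finsupp.single_apply]; split_ifs <;> simp
  | mono B B' q hB h ih => exact ih.trans hB

lemma HermRep.mul_lin {n : ℕ} {B : ℝ} {q : ℝ[X]} (h : HermRep n B q) (α β K : ℝ)
    (hK : |α| * (1 + n) + |β| ≤ K) : HermRep (n + 1) (K * B) ((C α * X + C β) * q) := by
  have hK0 : 0 ≤ K := le_trans (by positivity) hK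
  induction h with
  | zero => simpa using HermRep.zero
  | add c j hj B q h ih =>
    have h1 := HermRep.add (c * α) (j + 1) (by omega) _ _ ih
    have h2 := HermRep.add (c * α * j) (j - 1) (by omega) _ _ h1
    have h3 := HermRep.add (c * β) j (by omega) _ _ h2
    have e : (C α * X + C β) * q + C (c * α) * HR (j + 1) + C (c * α * j) * HR (j - 1)
        + C (c * β) * HR j = (C α * X + C β) * (q + C c * HR j) := by
      have := X_mul_HR j
      simp only [C_mul]
      linear_combination (-C c * C α) * this
    rw [e] at h3
    refine HermRep.mono _ _ _ ?_ h3
    rw [abs_mul, abs_mul, abs_mul, abs_mul, Nat.abs_cast]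
    have hj' : (j : ℝ) ≤ n := by exact_mod_cast hj
    have : |c| * (|α| * (1 + j) + |β|) ≤ |c| * K := by
      apply mul_le_mul_of_nonneg_left _ (abs_nonneg _)
      refine le_trans ?_ hK
      gcongr
    linarith
  | mono B B' q hB h ih => exact HermRep.mono _ _ _ (mul_le_mul_of_nonneg_left hB hK0) ih

lemma HermRep.prod (L : ℕ) (K : ℝ) (t : Finset ℕ) (α β : ℕ → ℝ)
    (h : ∀ m ∈ t, |α m| * (1 + L) + |β m| ≤ K) (ht : t.card ≤ L) :
    HermRep t.card (K ^ t.card) (∏ m ∈ t, (C (α m) * X + C (β m))) := by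
  induction t using Finset.induction_on with
  | empty =>
    have := HermRep.add (n := 0) 1 0 le_rfl _ _ HermRep.zero
    simpa [HR_zero] using this
  | insert a s ha ih =>
    rw [Finset.card_insert_of_notMem ha] at ht ⊢
    rw [Finset.prod_insert ha, pow_succ']
    refine (ih (fun m hm => h m (Finset.mem_insert_of_mem hm)) (by omega)).mul_lin _ _ _ ?_
    refine le_trans ?_ (h a (Finset.mem_insert_self _ _))
    have : (s.card : ℝ) ≤ L := by exact_mod_cast (by omega : s.card ≤ L)
    gcongr

/-- Coefficient bound from values at separated points. -/
lemma coeff_bound (L : ℕ) (hL : 1 ≤ L) (R δ S : ℝ) (hδ : 0 < δ) (x : ℕ → ℝ)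
    (hx : ∀ m < L, |x m| ≤ R)
    (hsep : ∀ m < L, ∀ m' < L, m ≠ m' → δ ≤ |x m - x m'|)
    (p : ℝ[X]) (hp : p.degree < L) (hS : ∀ m < L, |p.eval (x m)| ≤ S) (a : ℕ) :
    |HB.repr p a| ≤ L * (S * (δ⁻¹ * (1 + L + R)) ^ (L - 1)) := by
  have hinj : Set.InjOn x (Finset.range L : Set ℕ) := by
    intro m hm m' hm' e
    by_contra hne
    have := hsep m (by simpa using hm) m' (by simpa using hm') hne
    rw [e] at this; simp at this; linarith
  have hI := Lagrange.eq_interpolate hinj (f := p) (by simpa using hp)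
  rw [Lagrange.interpolate_apply] at hI
  have h1 : HB.repr p a = ∑ m ∈ Finset.range L,
      p.eval (x m) * HB.repr (Lagrange.basis (Finset.range L) x m) a := by
    conv_lhs => rw [hI]
    simp [← Polynomial.smul_eq_C_mul, map_sum, Finsupp.finset_sum_apply]
  rw [h1]
  refine (Finset.abs_sum_le_sum_abs _ _).trans ?_
  have : ∀ m ∈ Finset.range L,
      |p.eval (x m) * HB.repr (Lagrange.basis (Finset.range L) x m) a|
        ≤ S * (δ⁻¹ * (1 + L + R)) ^ (L - 1) := by
    intro m hm
    have hm' : m < L := by simpa using hm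
    rw [abs_mul]
    have hS0 : 0 ≤ S := (abs_nonneg _).trans (hS m hm')
    refine mul_le_mul (hS m hm') ?_ (abs_nonneg _) hS0
    have hc : ((Finset.range L).erase m).card = L - 1 := by
      rw [Finset.card_erase_of_mem hm, Finset.card_range]
    have := HermRep.prod L (δ⁻¹ * (1 + L + R)) ((Finset.range L).erase m)
      (fun j => (x m - x j)⁻¹) (fun j => -((x m - x j)⁻¹ * x j)) ?_ (by omega)
    · rw [hc] at this
      have e : Lagrange.basis (Finset.range L) x m = ∏ j ∈ (Finset.range L).erase m,
          (C ((x m - x j)⁻¹) * X + C (-((x m - x j)⁻¹ * x j))) := by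
        unfold Lagrange.basis
        refine Finset.prod_congr rfl fun j _ => ?_
        unfold Lagrange.basisDivisor
        simp only [C_neg, C_mul]; ring
      rw [e]; exact this.bound a
    · intro j hj
      rw [Finset.mem_erase, Finset.mem_range] at hj
      have hs := hsep m hm' j hj.2 (Ne.symm hj.1)
      rw [abs_neg, abs_mul, abs_inv]
      have h2 : |x m - x j|⁻¹ ≤ δ⁻¹ := inv_anti₀ hδ hs
      have h3 := hx j hj.2
      have h4 : 0 ≤ R := (abs_nonneg _).trans h3
      calc |x m - x j|⁻¹ * (1 + L) + |x m - x j|⁻¹ * |x j|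
          = |x m - x j|⁻¹ * (1 + L + |x j|) := by ring
        _ ≤ _ := by gcongr
  refine (Finset.sum_le_sum this).trans ?_
  simp

/-- Points where `p` is small. -/
lemma exists_pt (R a δ : ℝ) (hδ : 0 < δ) (ha : -R ≤ a) (hb : a + δ ≤ R) (p : ℝ[X]) :
    ∃ y ∈ Set.Icc a (a + δ), p.eval y ^ 2 ≤
      (∫ x in Set.Icc (-R) R, p.eval x ^ 2 * Real.exp (-x ^ 2 / 2)) * Real.exp (R ^ 2 / 2) / δ := by
  have hcont : Continuous fun x : ℝ => p.eval x ^ 2 := by fun_prop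
  obtain ⟨y, hy, hmin⟩ := (isCompact_Icc (a := a) (b := a + δ)).exists_isMinOn
    ⟨a, by simp [hδ.le]⟩ hcont.continuousOn
  refine ⟨y, hy, ?_⟩
  have hcw : Continuous fun x : ℝ => p.eval x ^ 2 * Real.exp (-x ^ 2 / 2) := by fun_prop
  have h1 : (p.eval y ^ 2 * Real.exp (-R ^ 2 / 2)) * δ ≤
      ∫ x in Set.Icc a (a + δ), p.eval x ^ 2 * Real.exp (-x ^ 2 / 2) := by
    have := setIntegral_ge_of_const_le_real (μ := volume) (s := Set.Icc a (a + δ))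
      (c := p.eval y ^ 2 * Real.exp (-R ^ 2 / 2))
      (f := fun x => p.eval x ^ 2 * Real.exp (-x ^ 2 / 2)) measurableSet_Icc (by simp) ?_
      (hcw.continuousOn.integrableOn_compact isCompact_Icc)
    · simpa [Measure.real, hδ.le] using this
    · intro x hx
      have := hmin hx
      simp only [Set.mem_setOf_eq] at this
      have h2 : x ^ 2 ≤ R ^ 2 := by
        apply sq_le_sq' <;> linarith [hx.1, hx.2]
      gcongr
  have h2 : ∫ x in Set.Icc a (a + δ), p.eval x ^ 2 * Real.exp (-x ^ 2 / 2) ≤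
      ∫ x in Set.Icc (-R) R, p.eval x ^ 2 * Real.exp (-x ^ 2 / 2) := by
    apply setIntegral_mono_set (hcw.continuousOn.integrableOn_compact isCompact_Icc)
    · exact Filter.Eventually.of_forall fun x => by positivity
    · exact (Set.Icc_subset_Icc ha hb).eventuallyLE
  rw [le_div_iff₀ hδ]
  have h3 := mul_le_mul_of_nonneg_right (h1.trans h2) (Real.exp_pos (R ^ 2 / 2)).le
  have h4 : Real.exp (-R ^ 2 / 2) * Real.exp (R ^ 2 / 2) = 1 := by
    rw [← Real.exp_add]; ring_nf; simp
  calc p.eval y ^ 2 * δ = p.eval y ^ 2 * δ * (Real.exp (-R ^ 2 / 2) * Real.exp (R ^ 2 / 2)) := by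
        rw [h4, mul_one]
    _ = (p.eval y ^ 2 * Real.exp (-R ^ 2 / 2)) * δ * Real.exp (R ^ 2 / 2) := by ring
    _ ≤ _ := h3

/-- Coefficients bounded by the weighted L2 norm. -/
lemma coeff_bound_L2 (L : ℕ) (hL : 1 ≤ L) (R : ℝ) (hR : 0 < R) (p : ℝ[X]) (hp : p.degree < L)
    (a : ℕ) :
    (HB.repr p a) ^ 2 ≤ (L * ((L / R) * (1 + L + R)) ^ (L - 1)) ^ 2 *
      ((∫ x in Set.Icc (-R) R, p.eval x ^ 2 * Real.exp (-x ^ 2 / 2)) *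
        Real.exp (R ^ 2 / 2) * (L / R)) := by
  have hL0 : (0 : ℝ) < L := by exact_mod_cast hL
  set δ := R / L with hδ
  have hδ0 : 0 < δ := by positivity
  have hLδ : L * δ = R := by rw [hδ]; field_simp
  have hinv : δ⁻¹ = L / R := by rw [hδ, inv_div]
  set Q := ∫ x in Set.Icc (-R) R, p.eval x ^ 2 * Real.exp (-x ^ 2 / 2) with hQ
  have hex : ∀ m : ℕ, ∃ y : ℝ, m < L → (y ∈ Set.Icc (-R + 2 * m * δ) (-R + 2 * m * δ + δ) ∧
      p.eval y ^ 2 ≤ Q * Real.exp (R ^ 2 / 2) / δ) := by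
    intro m
    by_cases hm : m < L
    · have hm' : (m : ℝ) + 1 ≤ L := by exact_mod_cast hm
      have := exists_pt R (-R + 2 * m * δ) δ hδ0 (by have : 0 ≤ 2 * m * δ := by positivity
                                                     linarith) (by nlinarith) p
      obtain ⟨y, h1, h2⟩ := this
      exact ⟨y, fun _ => ⟨h1, h2⟩⟩
    · exact ⟨0, fun h => absurd h hm⟩
  choose x hx using hex
  have hsep1 : ∀ m < L, ∀ m' < L, m < m' → δ ≤ x m' - x m := by
    intro m hm m' hm' hlt
    have h1 := (hx m hm).1.2
    have h2 := (hx m' hm').1.1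
    have h3 : (m : ℝ) + 1 ≤ m' := by exact_mod_cast hlt
    nlinarith
  have key := coeff_bound L hL R δ (Real.sqrt (Q * Real.exp (R ^ 2 / 2) / δ)) hδ0 x ?_ ?_ p hp ?_ a
  · have hQ0 : 0 ≤ Q := by
      rw [hQ]; exact integral_nonneg fun x => by positivity
    have := pow_le_pow_left₀ (abs_nonneg _) key 2
    rw [sq_abs] at this
    refine this.trans (le_of_eq ?_)
    rw [hinv, mul_pow, mul_pow, Real.sq_sqrt (by positivity), mul_pow, div_eq_mul_inv _ δ, hinv]
    ring
  · intro m hm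
    have h1 := (hx m hm).1
    have hm' : (m : ℝ) + 1 ≤ L := by exact_mod_cast hm
    have : 0 ≤ 2 * m * δ := by positivity
    rw [abs_le]
    constructor
    · linarith [h1.1]
    · nlinarith [h1.2]
  · intro m hm m' hm' hne
    rcases lt_or_gt_of_ne hne with h | h
    · rw [abs_sub_comm]; exact (hsep1 m hm m' hm' h).trans (le_abs_self _)
    · exact (hsep1 m' hm' m hm h).trans (le_abs_self _)
  · intro m hm
    exact Real.abs_le_sqrt (hx m hm).2

lemma continuous_hermiteR (j : ℕ) : Continuous (hermiteR j) := by
  have : hermiteR j = fun x => (HR j).eval x := by ext x; rw [HR_eval]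
  rw [this]; fun_prop

lemma quad_eq (R : ℝ) (L : ℕ) (b : Fin L → ℝ) (p : ℝ[X]) (hp : p = ∑ j : Fin L, C (b j) * HR j) :
    ∫ x in Set.Icc (-R) R, p.eval x ^ 2 * Real.exp (-x ^ 2 / 2) =
      ∑ r : Fin L, b r * (Real.sqrt (2 * π) * (Nat.factorial r)) * (Vmat R L *ᵥ b) r := by
  have h1 : ∀ r : Fin L, b r * (Real.sqrt (2 * π) * (Nat.factorial r)) * (Vmat R L *ᵥ b) r =
      ∫ x in Set.Icc (-R) R, ∑ c : Fin L,
        (b r * hermiteR r x) * (b c * hermiteR c x) * Real.exp (-x ^ 2 / 2) := by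
    intro r
    rw [integral_finset_sum]
    · simp only [Matrix.mulVec, dotProduct, Vmat, Matrix.of_apply, Finset.mul_sum, Jint]
      refine Finset.sum_congr rfl fun c _ => ?_
      rw [← mul_assoc, mul_right_comm, ← integral_const_mul]
      refine integral_congr_ae (Filter.Eventually.of_forall fun x => ?_)
      have : Real.sqrt (2 * π) ≠ 0 := by positivity
      have : (Nat.factorial r : ℝ) ≠ 0 := by positivity
      simp only
      field_simp
    · intro c _
      have := continuous_hermiteR r
      have := continuous_hermiteR c
      exact Continuous.integrableOn_Icc (by fun_prop)
  simp_rw [h1]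
  rw [← integral_finset_sum]
  · refine integral_congr_ae (Filter.Eventually.of_forall fun x => ?_)
    simp only
    have : p.eval x = ∑ j : Fin L, b j * hermiteR j x := by
      rw [hp, Polynomial.eval_finset_sum]; simp [HR_eval]
    rw [this, sq, Finset.sum_mul_sum, Finset.sum_mul]
    simp_rw [Finset.sum_mul]
  · intro r _
    refine Continuous.integrableOn_Icc ?_
    refine continuous_finset_sum _ fun c _ => ?_
    have := continuous_hermiteR r
    have := continuous_hermiteR c
    fun_prop

lemma beta_bound (R : ℝ) (hR : 0 < R) (L : ℕ) (i : Fin L) (b : Fin L → ℝ)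
    (hb : Vmat R L *ᵥ b = Pi.single i 1) (a : Fin L) :
    |b a| ≤ (L * ((L / R) * (1 + L + R)) ^ (L - 1)) ^ 2 *
      (Real.sqrt (2 * π) * (Nat.factorial i) * Real.exp (R ^ 2 / 2) * (L / R)) := by
  have hL : 1 ≤ L := by have := i.2; omega
  set p : ℝ[X] := ∑ j : Fin L, C (b j) * HR j with hp
  have hrepr : ∀ a : Fin L, HB.repr p a = b a := by
    intro a
    rw [hp]
    simp only [← Polynomial.smul_eq_C_mul, ← HB_apply, map_sum, map_smul, Module.Basis.repr_self,
      Finsupp.finset_sum_apply, Finsupp.smul_apply, Finsupp.single_apply, smul_eq_mul]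
    simp [Fin.val_inj]
  have hdeg : p.degree < L := by
    rw [hp]
    refine (Polynomial.degree_sum_le _ _).trans_lt ?_
    rw [Finset.sup_lt_iff (by exact WithBot.bot_lt_coe L)]
    intro j _
    rw [← Polynomial.smul_eq_C_mul]
    refine lt_of_le_of_lt (Polynomial.degree_smul_le _ _) ?_
    rw [HR_degree]; exact_mod_cast j.2
  have hQ := quad_eq R L b p hp
  rw [hb] at hQ
  have hQ' : ∫ x in Set.Icc (-R) R, p.eval x ^ 2 * Real.exp (-x ^ 2 / 2) =
      b i * (Real.sqrt (2 * π) * (Nat.factorial i)) := by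
    rw [hQ, Finset.sum_eq_single i]
    · simp
    · intro r _ hr; simp [hr]
    · simp
  have hQ0 : 0 ≤ ∫ x in Set.Icc (-R) R, p.eval x ^ 2 * Real.exp (-x ^ 2 / 2) :=
    integral_nonneg fun x => by positivity
  have hpos : 0 < Real.sqrt (2 * π) * (Nat.factorial i : ℝ) := by positivity
  have hbi : 0 ≤ b i := by
    rw [hQ'] at hQ0
    exact nonneg_of_mul_nonneg_left hQ0 hpos
  set B := (L * ((L / R) * (1 + L + R)) ^ (L - 1)) ^ 2 *
      (Real.sqrt (2 * π) * (Nat.factorial i) * Real.exp (R ^ 2 / 2) * (L / R)) with hB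
  have hB0 : 0 ≤ B := by positivity
  have hall : ∀ a : Fin L, b a ^ 2 ≤ B * b i := by
    intro a
    have := coeff_bound_L2 L hL R hR p hdeg a
    rw [hrepr, hQ'] at this
    refine this.trans (le_of_eq ?_)
    rw [hB]; ring
  have h1 : b i ≤ B := by
    have := hall i
    by_contra hlt
    push Not at hlt
    nlinarith
  apply abs_le_of_sq_le_sq _ hB0
  calc b a ^ 2 ≤ B * b i := hall a
    _ ≤ B * B := by gcongr
    _ = B ^ 2 := by ring

end helpers

theorem abs_beta_le (R : ℝ) (hR : 0 < R) :
    ∃ C : ℝ, 0 < C ∧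
      ∀ (k ℓ : ℕ), 1 ≤ k → 2 * (2 * k - 1) ≤ ℓ →
        ∀ i : ℕ, 1 ≤ i → i ≤ 2 * k - 1 → ∀ hi : i < ℓ, ∀ a : Fin ℓ,
          |((Vmat R ℓ)⁻¹ *ᵥ Pi.single (⟨i, hi⟩ : Fin ℓ) (1 : ℝ)) a| ≤
            (2 : ℝ) ^ (C * ℓ * Real.log ℓ) := by
  obtain ⟨m, hm⟩ := pow_unbounded_of_one_lt
    (max (Real.sqrt (2 * π) * Real.exp (R ^ 2 / 2) / R) (2 / R + 1)) (one_lt_two (α := ℝ))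
  have hm1 := (le_max_left _ _).trans hm.le
  have hm2 := (le_max_right _ _).trans hm.le
  have hlog2 : 0 < Real.log 2 := Real.log_pos one_lt_two
  refine ⟨(8 + 3 * m : ℕ) / Real.log 2, by positivity, ?_⟩
  intro k ℓ hk hℓ i hi1 hik hi a
  have hℓ2 : 2 ≤ ℓ := by omega
  have hℓ2' : (2 : ℝ) ≤ ℓ := by exact_mod_cast hℓ2
  have hℓ1 : (1 : ℝ) ≤ ℓ := by linarith
  by_cases hV : IsUnit (Vmat R ℓ).det
  swap
  · rw [Matrix.nonsing_inv_apply_not_isUnit _ hV]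
    simp only [Matrix.zero_mulVec, Pi.zero_apply, abs_zero]
    positivity
  refine (beta_bound R hR ℓ ⟨i, hi⟩ _ ?_ a).trans ?_
  · rw [Matrix.mulVec_mulVec, Matrix.mul_nonsing_inv _ hV, Matrix.one_mulVec]
  have hrhs : (2 : ℝ) ^ (((8 + 3 * m : ℕ) : ℝ) / Real.log 2 * ℓ * Real.log ℓ) =
      (ℓ : ℝ) ^ ((8 + 3 * m) * ℓ) := by
    rw [Real.rpow_def_of_pos two_pos, ← Real.rpow_natCast, Real.rpow_def_of_pos (by linarith)]
    congr 1
    push_cast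
    field_simp
  rw [hrhs]
  have h2m : (2 : ℝ) ^ m ≤ (ℓ : ℝ) ^ m := by gcongr
  have hb : (ℓ / R) * (1 + ℓ + R) ≤ (ℓ : ℝ) ^ (m + 2) := by
    calc (ℓ / R) * (1 + ℓ + R) = ℓ * ((1 + ℓ) / R + 1) := by field_simp
      _ ≤ ℓ * (ℓ * (2 / R + 1)) := by
          gcongr
          have : (1 + ℓ) / R ≤ ℓ * (2 / R) := by
            rw [← mul_div_assoc]; gcongr; linarith
          linarith
      _ ≤ ℓ * (ℓ * ℓ ^ m) := by gcongr; linarith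
      _ = _ := by ring
  have hfac : (Nat.factorial i : ℝ) ≤ (ℓ : ℝ) ^ ℓ := by
    have h1 : Nat.factorial i ≤ ℓ ^ ℓ :=
      (Nat.factorial_le hi.le).trans (Nat.factorial_le_pow ℓ)
    exact_mod_cast h1
  have hc : Real.sqrt (2 * π) * Real.exp (R ^ 2 / 2) / R ≤ (ℓ : ℝ) ^ m := hm1.trans h2m
  calc _ = (ℓ * ((ℓ / R) * (1 + ℓ + R)) ^ (ℓ - 1)) ^ 2 *
      ((Real.sqrt (2 * π) * Real.exp (R ^ 2 / 2) / R) * (Nat.factorial i) * ℓ) := by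
        simp only; ring
    _ ≤ (ℓ * ((ℓ : ℝ) ^ (m + 2)) ^ (ℓ - 1)) ^ 2 * ((ℓ : ℝ) ^ m * (ℓ : ℝ) ^ ℓ * ℓ) := by gcongr
    _ = (ℓ : ℝ) ^ ((1 + (m + 2) * (ℓ - 1)) * 2 + (m + ℓ + 1)) := by ring
    _ ≤ _ := by
      apply pow_le_pow_right₀ hℓ1
      obtain ⟨n, rfl⟩ : ∃ n, ℓ = n + 1 := ⟨ℓ - 1, by omega⟩
      simp only [Nat.add_sub_cancel]
      nlinarith [Nat.zero_le (m * n), Nat.zero_le n, Nat.zero_le m]
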